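/- arXiv:1102.1142 — 2 statements merged into one kernel-verified Lean document; each statement's English description precedes it below -/
import Mathlib

section
/- Let G be a finite simple very well-covered graph, let B be a local maximum stable set of G, let v be a vertex not in B, and suppose A = B ∪ {v} is a stable set in G. Then A is a local maximum stable set of G if and only if |N(A)| = |N(B)| + 1. -/
open Classical

variable {V : Type*} [Fintype V] [DecidableEq V]

/-- `S` is a stable (independent) set of vertices in `G`. -/
def IsStable (G : SimpleGraph V) (S : Finset V) : Prop :=
  ∀ ⦃x⦄, x ∈ S → ∀ ⦃y⦄, y ∈ S → ¬G.Adj x y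

/-- The open neighborhood `N(S)`: vertices outside `S` having a neighbor in `S`. -/
noncomputable def nbhd (G : SimpleGraph V) (S : Finset V) : Finset V :=
  Finset.univ.filter fun v => v ∉ S ∧ ∃ u ∈ S, G.Adj u v

/-- The closed neighborhood `N[S] = S ∪ N(S)`. -/
noncomputable def closedNbhd (G : SimpleGraph V) (S : Finset V) : Finset V :=
  S ∪ nbhd G S

/-- The stability (independence) number of the subgraph of `G` induced by `A`. -/
noncomputable def alphaOn (G : SimpleGraph V) (A : Finset V) : ℕ :=
  sSup {n | ∃ S ⊆ A, IsStable G S ∧ S.card = n}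

/-- The stability (independence) number `α(G)`. -/
noncomputable def alpha (G : SimpleGraph V) : ℕ :=
  alphaOn G Finset.univ

/-- `S` is a maximum stable set of the subgraph of `G` induced by `N[S]`. -/
def IsLocalMaxStable (G : SimpleGraph V) (S : Finset V) : Prop :=
  IsStable G S ∧ S.card = alphaOn G (closedNbhd G S)

/-- `Ψ(G)`: the family of all local maximum stable sets of `G`. -/
def Psi (G : SimpleGraph V) : Set (Finset V) :=
  {S | IsLocalMaxStable G S}

/-- A matching of `G`: a set of pairwise disjoint edges of `G`. -/
def IsGMatching (G : SimpleGraph V) (M : Finset (Sym2 V)) : Prop :=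
  (∀ e ∈ M, e ∈ G.edgeSet) ∧
    ∀ e ∈ M, ∀ f ∈ M, e ≠ f → ∀ v : V, v ∈ e → v ∉ f

/-- A matching of `G` all of whose edges have both endpoints inside `A`,
i.e. a matching of the subgraph of `G` induced by `A`. -/
def IsGMatchingOn (G : SimpleGraph V) (A : Finset V) (M : Finset (Sym2 V)) : Prop :=
  IsGMatching G M ∧ ∀ e ∈ M, ∀ v : V, v ∈ e → v ∈ A

/-- The matching number of the subgraph of `G` induced by `A`. -/
noncomputable def muOn (G : SimpleGraph V) (A : Finset V) : ℕ :=
  sSup {n | ∃ M, IsGMatchingOn G A M ∧ M.card = n}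

/-- The matching number `μ(G)`. -/
noncomputable def mu (G : SimpleGraph V) : ℕ :=
  muOn G Finset.univ

/-- A maximum matching of `G`. -/
def IsMaximumGMatching (G : SimpleGraph V) (M : Finset (Sym2 V)) : Prop :=
  IsGMatching G M ∧ M.card = mu G

/-- The matching `M` saturates the vertex `v`. -/
def MSaturates (M : Finset (Sym2 V)) (v : V) : Prop :=
  ∃ e ∈ M, v ∈ e

/-- A perfect matching of `G`: a matching saturating every vertex. -/
def IsPerfectGMatching (G : SimpleGraph V) (M : Finset (Sym2 V)) : Prop :=
  IsGMatching G M ∧ ∀ v : V, MSaturates M v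

/-- The set of vertices saturated by `M`. -/
noncomputable def msupp (M : Finset (Sym2 V)) : Finset V :=
  Finset.univ.filter fun v => ∃ e ∈ M, v ∈ e

/-- `M` is a uniquely restricted matching: it is the unique perfect matching of
the subgraph of `G` induced by the set of vertices saturated by `M`. -/
def UniquelyRestricted (G : SimpleGraph V) (M : Finset (Sym2 V)) : Prop :=
  IsGMatching G M ∧
    ∀ M' : Finset (Sym2 V), IsGMatchingOn G (msupp M) M' →
      (∀ v ∈ msupp M, MSaturates M' v) → M' = M

/-- Accessibility property of a set system. -/
def AccessibleFam (F : Set (Finset V)) : Prop :=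
  ∀ X ∈ F, X ≠ ∅ → ∃ x ∈ X, X.erase x ∈ F

/-- Exchange property of a set system. -/
def ExchangeFam (F : Set (Finset V)) : Prop :=
  ∀ X ∈ F, ∀ Y ∈ F, X.card = Y.card + 1 → ∃ x ∈ X, x ∉ Y ∧ insert x Y ∈ F

/-- A greedoid: a nonempty set system satisfying accessibility and exchange. -/
def IsGreedoidFam (F : Set (Finset V)) : Prop :=
  F.Nonempty ∧ AccessibleFam F ∧ ExchangeFam F

/-- A maximal stable set. -/
def IsMaximalStable (G : SimpleGraph V) (S : Finset V) : Prop :=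
  IsStable G S ∧ ∀ T, IsStable G T → S ⊆ T → S = T

/-- `G` is well-covered: all maximal stable sets have the same cardinality. -/
def WellCovered (G : SimpleGraph V) : Prop :=
  ∀ S T, IsMaximalStable G S → IsMaximalStable G T → S.card = T.card

/-- `G` is very well-covered: well-covered, no isolated vertices, `|V| = 2α(G)`. -/
def VeryWellCovered (G : SimpleGraph V) : Prop :=
  WellCovered G ∧ (∀ v : V, ∃ u, G.Adj v u) ∧ Fintype.card V = 2 * alpha G

/-- The subgraph of `G` induced by `A` is a König-Egerváry graph. -/
def KonigEgervaryOn (G : SimpleGraph V) (A : Finset V) : Prop :=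
  alphaOn G A + muOn G A = A.card

/-- `G` is a König-Egerváry graph: `α(G) + μ(G) = |V(G)|`. -/
def KonigEgervary (G : SimpleGraph V) : Prop :=
  alpha G + mu G = Fintype.card V

/-- The cycle `c` is alternating with respect to `M`: of every two incident
edges of `c` exactly one belongs to `M`. -/
def IsAlternatingCycle (G : SimpleGraph V) (M : Finset (Sym2 V)) {v : V}
    (c : G.Walk v v) : Prop :=
  c.IsCycle ∧ ∀ e ∈ c.edges, ∀ f ∈ c.edges, e ≠ f →
    (∃ u : V, u ∈ e ∧ u ∈ f) → (e ∈ M ↔ f ∉ M)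

/-- `G` contains an `M`-alternating cycle. -/
def HasAlternatingCycle (G : SimpleGraph V) (M : Finset (Sym2 V)) : Prop :=
  ∃ (v : V) (c : G.Walk v v), IsAlternatingCycle G M c

/-- The cycle `c` is chordless: the subgraph induced by its vertices has no
edges other than the cycle edges. -/
def ChordlessCycle (G : SimpleGraph V) {v : V} (c : G.Walk v v) : Prop :=
  ∀ x ∈ c.support, ∀ y ∈ c.support, G.Adj x y → s(x, y) ∈ c.edges

theorem mem_nbhd {G : SimpleGraph V} {S : Finset V} {x : V} :
    x ∈ nbhd G S ↔ x ∉ S ∧ ∃ u ∈ S, G.Adj u x := by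
  simp [nbhd]

theorem card_le_alphaOn {G : SimpleGraph V} {A S : Finset V} (hSA : S ⊆ A)
    (hS : IsStable G S) : S.card ≤ alphaOn G A :=
  le_csSup ⟨A.card, by rintro n ⟨T, hT, -, rfl⟩; exact Finset.card_le_card hT⟩
    ⟨S, hSA, hS, rfl⟩

theorem exists_card_eq_alphaOn (G : SimpleGraph V) (A : Finset V) :
    ∃ S ⊆ A, IsStable G S ∧ S.card = alphaOn G A :=
  Nat.sSup_mem (s := {n | ∃ S ⊆ A, IsStable G S ∧ S.card = n})
    ⟨0, ∅, by simp, by simp [IsStable], rfl⟩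
    ⟨A.card, by rintro n ⟨T, hT, -, rfl⟩; exact Finset.card_le_card hT⟩

/-- In a well-covered graph every stable set is contained in a maximum stable set. -/
theorem WellCovered.exists_superset_card_eq_alpha {G : SimpleGraph V} (hG : WellCovered G)
    {S : Finset V} (hS : IsStable G S) :
    ∃ T, S ⊆ T ∧ IsStable G T ∧ T.card = alpha G := by
  obtain ⟨I, -, hI, hIcard⟩ := exists_card_eq_alphaOn G Finset.univ
  have hImax : IsMaximalStable G I := by
    refine ⟨hI, fun T hT hIT => Finset.eq_of_subset_of_card_le hIT ?_⟩
    rw [hIcard]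
    exact card_le_alphaOn (Finset.subset_univ _) hT
  obtain ⟨T, hT, hTmax⟩ := Finset.exists_max_image
    (Finset.univ.filter fun T => S ⊆ T ∧ IsStable G T) Finset.card ⟨S, by simp [hS]⟩
  simp only [Finset.mem_filter, Finset.mem_univ, true_and] at hT hTmax
  refine ⟨T, hT.1, hT.2, (hG T I ⟨hT.2, fun U hU hTU => ?_⟩ hImax).trans hIcard⟩
  exact Finset.eq_of_subset_of_card_le hTU (hTmax U ⟨hT.1.trans hTU, hU⟩)

/-- Berge's inequality for stable sets of well-covered graphs without isolated vertices. -/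
theorem WellCovered.card_le_card_nbhd {G : SimpleGraph V} (hG : WellCovered G)
    (hiso : ∀ v : V, ∃ u, G.Adj v u) (S : Finset V) (hS : IsStable G S) :
    S.card ≤ (nbhd G S).card := by
  induction S using Finset.strongInduction with
  | H S ih =>
  rcases S.eq_empty_or_nonempty with rfl | ⟨s, hs⟩
  · simp
  obtain ⟨y, hsy⟩ := hiso s
  obtain ⟨J, hyJ, hJ, hJcard⟩ := hG.exists_superset_card_eq_alpha
    (S := {y}) (by simp [IsStable])
  rw [Finset.singleton_subset_iff] at hyJ
  have hsJ : s ∉ J := fun h => hJ h hyJ hsy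
  have hlt : S ∩ J ⊂ S :=
    Finset.ssubset_iff_subset_ne.2 ⟨Finset.inter_subset_left, fun h =>
      hsJ (Finset.mem_inter.1 (h ▸ hs)).2⟩
  have hind := ih (S ∩ J) hlt fun a ha b hb =>
    hS (Finset.mem_inter.1 ha).1 (Finset.mem_inter.1 hb).1
  have hstable : IsStable G (J \ nbhd G S ∪ S) := by
    intro a ha b hb hab
    have hab' := hab.symm
    simp only [Finset.mem_union, Finset.mem_sdiff, mem_nbhd] at ha hb
    have := @hS a
    have := @hS b
    have := @hJ a
    grind
  have hexch : (S \ J).card ≤ (nbhd G S ∩ J).card := by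
    have h₁ := card_le_alphaOn (Finset.subset_univ _) hstable
    change _ ≤ alpha G at h₁
    have h₂ : Disjoint (J \ nbhd G S) (S \ J) :=
      Finset.disjoint_left.2 fun a ha hb =>
        (Finset.mem_sdiff.1 hb).2 (Finset.mem_sdiff.1 ha).1
    have h₃ := Finset.card_le_card (show J \ nbhd G S ∪ S \ J ⊆ J \ nbhd G S ∪ S by grind)
    rw [Finset.card_union_of_disjoint h₂] at h₃
    have h₄ := Finset.card_sdiff_add_card_inter J (nbhd G S)
    rw [Finset.inter_comm] at h₄
    omega
  have hdisj : Disjoint (nbhd G S ∩ J) (nbhd G (S ∩ J)) := by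
    rw [Finset.disjoint_left]
    intro a ha hb
    obtain ⟨-, u, hu, hua⟩ := mem_nbhd.1 hb
    exact hJ (Finset.mem_inter.1 hu).2 (Finset.mem_inter.1 ha).2 hua
  have hsub : nbhd G S ∩ J ∪ nbhd G (S ∩ J) ⊆ nbhd G S := by
    refine Finset.union_subset Finset.inter_subset_left fun a ha => ?_
    obtain ⟨-, u, hu, hua⟩ := mem_nbhd.1 ha
    have huS := (Finset.mem_inter.1 hu).1
    exact mem_nbhd.2 ⟨fun haS => hS huS haS hua, u, huS, hua⟩
  have h₁ := Finset.card_le_card hsub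
  rw [Finset.card_union_of_disjoint hdisj] at h₁
  have h₂ := Finset.card_sdiff_add_card_inter S J
  omega

/-- A very well-covered graph has a perfect matching, given here as an involution. -/
theorem VeryWellCovered.exists_matching {G : SimpleGraph V} (hG : VeryWellCovered G) :
    ∃ σ : V → V, Function.Involutive σ ∧ ∀ x, G.Adj x (σ x) := by
  obtain ⟨hwc, hiso, hcard⟩ := hG
  obtain ⟨I, -, hI, hIcard⟩ := exists_card_eq_alphaOn G Finset.univ
  change I.card = alpha G at hIcard
  obtain ⟨f, hf, hfadj⟩ := (Finset.all_card_le_biUnion_card_iff_exists_injective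
    (fun x : I => Finset.univ.filter (G.Adj x))).1 (by
      intro S
      have hsub : S.map (Function.Embedding.subtype _) ⊆ I := by
        intro x hx
        obtain ⟨y, -, rfl⟩ := Finset.mem_map.1 hx
        exact y.2
      have h := hwc.card_le_card_nbhd hiso (S.map (Function.Embedding.subtype _))
        fun a ha b hb => hI (hsub ha) (hsub hb)
      rw [Finset.card_map] at h
      refine h.trans (Finset.card_le_card fun x hx => ?_)
      obtain ⟨-, u, hu, hux⟩ := mem_nbhd.1 hx
      obtain ⟨y, hy, rfl⟩ := Finset.mem_map.1 hu
      exact Finset.mem_biUnion.2 ⟨y, hy, by simpa using hux⟩)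
  simp only [Finset.mem_filter, Finset.mem_univ, true_and] at hfadj
  have hfI : ∀ x : I, f x ∉ I := fun x h => hI x.2 h (hfadj x)
  have himage : Finset.univ.image f = Iᶜ := by
    refine Finset.eq_of_subset_of_card_le (fun y hy => ?_) ?_
    · obtain ⟨x, -, rfl⟩ := Finset.mem_image.1 hy
      exact Finset.mem_compl.2 (hfI x)
    · rw [Finset.card_image_of_injective _ hf, Finset.card_compl, Finset.card_univ,
        Fintype.card_coe]
      omega
  have hex : ∀ x, ∃ y, (∃ h : x ∈ I, f ⟨x, h⟩ = y) ∨ ∃ h : y ∈ I, f ⟨y, h⟩ = x := by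
    intro x
    by_cases hx : x ∈ I
    · exact ⟨_, Or.inl ⟨hx, rfl⟩⟩
    · rw [← Finset.mem_compl, ← himage] at hx
      obtain ⟨y, -, hy⟩ := Finset.mem_image.1 hx
      exact ⟨y, Or.inr ⟨y.2, hy⟩⟩
  choose σ hσ using hex
  refine ⟨σ, fun x => ?_, fun x => ?_⟩
  · rcases hσ x with ⟨hx, h⟩ | ⟨hx, h⟩ <;> rcases hσ (σ x) with ⟨hy, h'⟩ | ⟨hy, h'⟩
    · exact absurd (h ▸ hy) (hfI _)
    · exact congrArg Subtype.val (hf (h'.trans h.symm))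
    · exact h'.symm.trans h
    · exact absurd (h' ▸ hx) (hfI _)
  · rcases hσ x with ⟨hx, h⟩ | ⟨hx, h⟩
    · exact h ▸ hfadj ⟨x, hx⟩
    · have h' := hfadj ⟨σ x, hx⟩
      rw [h] at h'
      exact h'.symm

/-- Along an edge of a perfect matching of a very well-covered graph, every neighbor of one
end is adjacent to every neighbor of the other. -/
theorem VeryWellCovered.adj_of_adj_of_adj_matching {G : SimpleGraph V} (hG : VeryWellCovered G)
    {σ : V → V} (hσ : Function.Involutive σ) (hadj : ∀ x, G.Adj x (σ x)) {a b x : V}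
    (ha : G.Adj a x) (hb : G.Adj b (σ x)) : G.Adj a b := by
  by_contra hab
  have hba : ¬G.Adj b a := fun h => hab h.symm
  obtain ⟨J, hsub, hJ, hJcard⟩ := hG.1.exists_superset_card_eq_alpha
    (S := {a, b}) (by simp [IsStable, hab, hba])
  have hdisj : Disjoint J (J.image σ) := by
    rw [Finset.disjoint_left]
    intro y hy hy'
    obtain ⟨z, hz, rfl⟩ := Finset.mem_image.1 hy'
    exact hJ hz hy (hadj z)
  have huniv : J ∪ J.image σ = Finset.univ := by
    apply Finset.eq_univ_of_card
    rw [Finset.card_union_of_disjoint hdisj, Finset.card_image_of_injective _ hσ.injective,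
      hG.2.2]
    omega
  have hx : x ∈ J ∪ J.image σ := huniv ▸ Finset.mem_univ x
  rcases Finset.mem_union.1 hx with hx | hx
  · exact hJ (hsub (by simp)) hx ha
  · obtain ⟨z, hz, rfl⟩ := Finset.mem_image.1 hx
    rw [hσ z] at hb
    exact hJ (hsub (by simp)) hz hb

theorem VeryWellCovered.mem_psi_iff_card_nbhd {G : SimpleGraph V} (hG : VeryWellCovered G)
    {S : Finset V} (hS : IsStable G S) : S ∈ Psi G ↔ (nbhd G S).card = S.card := by
  obtain ⟨σ, hσ, hadj⟩ := hG.exists_matching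
  have himage : S.image σ ⊆ nbhd G S := by
    intro x hx
    obtain ⟨s, hs, rfl⟩ := Finset.mem_image.1 hx
    exact mem_nbhd.2 ⟨fun h => hS hs h (hadj s), s, hs, hadj s⟩
  have hcard : (S.image σ).card = S.card := Finset.card_image_of_injective _ hσ.injective
  constructor
  · rintro ⟨-, hmax⟩
    suffices h : S.image σ = nbhd G S by rw [← h, hcard]
    refine himage.antisymm fun w hw => ?_
    by_contra hwσ
    have hP : ∀ {a b x : V}, G.Adj a x → G.Adj b (σ x) → G.Adj a b :=
      hG.adj_of_adj_of_adj_matching hσ hadj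
    have hnot : ∀ {s}, G.Adj w s → ¬G.Adj w (σ s) := fun h h' => G.irrefl (hP h h')
    have hwS := (mem_nbhd.1 hw).1
    let g : V → V := fun s => if G.Adj w s then σ s else s
    have hwg : ∀ s ∈ S, ¬G.Adj w (g s) := by
      intro s hs h
      by_cases hws : G.Adj w s
      · simp only [g, if_pos hws] at h
        exact hnot hws h
      · simp only [g, if_neg hws] at h
        exact hws h
    have hgg : ∀ s ∈ S, ∀ t ∈ S, ¬G.Adj (g s) (g t) := by
      intro s hs t ht h
      by_cases hws : G.Adj w s <;> by_cases hwt : G.Adj w t <;>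
        simp only [g, hws, hwt, if_true, if_false] at h
      · exact hnot hwt (hP hws h.symm)
      · exact hwt (hP hws h.symm)
      · exact hws (hP hwt h)
      · exact hS hs ht h
    have hinj : Set.InjOn g S := by
      intro s hs t ht h
      by_cases hws : G.Adj w s <;> by_cases hwt : G.Adj w t <;>
        simp only [g, hws, hwt, if_true, if_false] at h
      · exact hσ.injective h
      · exact absurd (h ▸ hadj s) (hS hs ht)
      · exact absurd (h ▸ hadj t) (hS ht hs)
      · exact h
    have hwimage : w ∉ S.image g := by
      intro h
      obtain ⟨s, hs, hsw⟩ := Finset.mem_image.1 h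
      by_cases hws : G.Adj w s
      · simp only [g, if_pos hws] at hsw
        exact hwσ (hsw ▸ Finset.mem_image_of_mem σ hs)
      · simp only [g, if_neg hws] at hsw
        exact hwS (hsw ▸ hs)
    have hle := card_le_alphaOn (G := G) (A := closedNbhd G S) (S := insert w (S.image g)) (by
      refine Finset.insert_subset (Finset.mem_union_right _ hw) fun x hx => ?_
      obtain ⟨s, hs, rfl⟩ := Finset.mem_image.1 hx
      by_cases hws : G.Adj w s
      · simp only [g, if_pos hws]
        exact Finset.mem_union_right _ (himage (Finset.mem_image_of_mem σ hs))
      · simp only [g, if_neg hws]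
        exact Finset.mem_union_left _ hs) (by
      intro a ha b hb
      rcases Finset.mem_insert.1 ha with rfl | ha <;> rcases Finset.mem_insert.1 hb with rfl | hb
      · exact G.irrefl
      · obtain ⟨t, ht, rfl⟩ := Finset.mem_image.1 hb
        exact hwg t ht
      · obtain ⟨s, hs, rfl⟩ := Finset.mem_image.1 ha
        exact fun h => hwg s hs h.symm
      · obtain ⟨s, hs, rfl⟩ := Finset.mem_image.1 ha
        obtain ⟨t, ht, rfl⟩ := Finset.mem_image.1 hb
        exact hgg s hs t ht)
    rw [Finset.card_insert_of_notMem hwimage, Finset.card_image_of_injOn hinj] at hle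
    omega
  · intro h
    refine ⟨hS, (card_le_alphaOn (A := closedNbhd G S) Finset.subset_union_left hS).antisymm ?_⟩
    have heq : S.image σ = nbhd G S := Finset.eq_of_subset_of_card_le himage (by omega)
    obtain ⟨T, hTS, hT, hTcard⟩ := exists_card_eq_alphaOn G (closedNbhd G S)
    have hdisj : Disjoint T (T.image σ) := by
      rw [Finset.disjoint_left]
      intro y hy hy'
      obtain ⟨z, hz, rfl⟩ := Finset.mem_image.1 hy'
      exact hT hz hy (hadj z)
    have hsub : T ∪ T.image σ ⊆ closedNbhd G S := by
      refine Finset.union_subset hTS fun x hx => ?_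
      obtain ⟨z, hz, rfl⟩ := Finset.mem_image.1 hx
      have hz := hTS hz
      rw [closedNbhd, ← heq] at hz ⊢
      rcases Finset.mem_union.1 hz with hz | hz
      · exact Finset.mem_union_right _ (Finset.mem_image_of_mem σ hz)
      · obtain ⟨s, hs, rfl⟩ := Finset.mem_image.1 hz
        rw [hσ s]
        exact Finset.mem_union_left _ hs
    have hle := (Finset.card_le_card hsub).trans (Finset.card_union_le _ _)
    rw [Finset.card_union_of_disjoint hdisj, Finset.card_image_of_injective _ hσ.injective]
      at hle
    omega

/-- If `B ∈ Ψ(G)`, `v ∉ B`, and `A = B ∪ {v}` is stable in the very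
well-covered graph `G`, then `A ∈ Ψ(G)` iff `|N(A)| = |N(B)| + 1`. -/
theorem insert_mem_psi_iff (G : SimpleGraph V) (hG : VeryWellCovered G)
    (B : Finset V) (hB : B ∈ Psi G) (v : V) (hv : v ∉ B)
    (hA : IsStable G (insert v B)) :
    insert v B ∈ Psi G ↔ (nbhd G (insert v B)).card = (nbhd G B).card + 1 := by
  rw [hG.mem_psi_iff_card_nbhd hA, Finset.card_insert_of_notMem hv,
    (hG.mem_psi_iff_card_nbhd hB.1).1 hB]
end

section
/- Let G be a finite simple very well-covered graph and let M be a maximum matching of G. Then G contains an M-alternating cycle if and only if G contains an M-alternating chordless cycle of length four. -/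
open Classical

variable {V : Type*} [Fintype V] [DecidableEq V]

section AlternatingCycle

variable {W : Type*} {G : SimpleGraph W} {M : Finset (Sym2 W)}

lemma IsPerfectGMatching.exists_partner (hM : IsPerfectGMatching G M) :
    ∃ m : W → W, ∀ u v, s(u, v) ∈ M ↔ v = m u := by
  have h : ∀ v, ∃ w, s(v, w) ∈ M := fun v => by
    obtain ⟨e, he, w, rfl⟩ := hM.2 v
    exact ⟨w, he⟩
  choose m hm using h
  refine ⟨m, fun u v => ⟨fun huv => ?_, fun h => h ▸ hm u⟩⟩
  by_contra hne
  refine hM.1.2 _ huv _ (hm u) (fun h => hne ?_) u (Sym2.mem_mk_left _ _) (Sym2.mem_mk_left _ _)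
  rcases Sym2.eq_iff.1 h with h | h
  · exact h.2
  · exact h.2.trans h.1

lemma IsAlternatingCycle.reverse {v : W} {c : G.Walk v v} (hc : IsAlternatingCycle G M c) :
    IsAlternatingCycle G M c.reverse := by
  refine ⟨hc.1.reverse, ?_⟩
  simpa only [SimpleGraph.Walk.edges_reverse, List.mem_reverse] using hc.2

lemma edge_getVert_ne_edge_getVert {v w : W} {c : G.Walk v w} (hc : c.IsTrail) {i j : ℕ}
    (hi : i < c.length) (hj : j < c.length) (hij : i ≠ j) :
    s(c.getVert i, c.getVert (i + 1)) ≠ s(c.getVert j, c.getVert (j + 1)) := by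
  rw [← c.length_edges] at hi hj
  rw [← c.getElem_edges hi, ← c.getElem_edges hj]
  exact fun h => hij ((hc.edges_nodup.getElem_inj_iff).1 h)

lemma edge_getVert_mem_edges {v w : W} (c : G.Walk v w) {i : ℕ} (hi : i < c.length) :
    s(c.getVert i, c.getVert (i + 1)) ∈ c.edges := by
  rw [← c.length_edges] at hi
  exact c.getElem_edges hi ▸ List.getElem_mem hi

lemma IsAlternatingCycle.getVert_edge_mem_iff {v : W} {c : G.Walk v v}
    (hc : IsAlternatingCycle G M c) (h₀ : s(c.getVert 0, c.getVert 1) ∈ M) {i : ℕ}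
    (hi : i < c.length) : s(c.getVert i, c.getVert (i + 1)) ∈ M ↔ Even i := by
  have hlen := hc.1.three_le_length
  induction i with
  | zero => simpa using h₀
  | succ i ih =>
    have hne : s(c.getVert i, c.getVert (i + 1)) ≠ s(c.getVert (i + 1), c.getVert (i + 1 + 1)) :=
      edge_getVert_ne_edge_getVert hc.1.isTrail (by omega) hi (by omega)
    have h := hc.2 _ (edge_getVert_mem_edges c (by omega)) _ (edge_getVert_mem_edges c hi) hne
      ⟨c.getVert (i + 1), by simp, by simp⟩
    have ih := ih (by omega)
    rw [Nat.even_add_one]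
    tauto

lemma IsAlternatingCycle.even_length {v : W} {c : G.Walk v v}
    (hc : IsAlternatingCycle G M c) (h₀ : s(c.getVert 0, c.getVert 1) ∈ M) : Even c.length := by
  have hlen := hc.1.three_le_length
  obtain ⟨n, hn⟩ : ∃ n, c.length = n + 1 := ⟨c.length - 1, by omega⟩
  have hlast : c.getVert (n + 1) = c.getVert 0 := by
    rw [← hn, c.getVert_length, c.getVert_zero]
  have hne : s(c.getVert n, c.getVert (n + 1)) ≠ s(c.getVert 0, c.getVert (0 + 1)) :=
    edge_getVert_ne_edge_getVert hc.1.isTrail (by omega) (by omega) (by omega)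
  have h := hc.2 _ (edge_getVert_mem_edges c (by omega)) _ (edge_getVert_mem_edges c (by omega)) hne
    ⟨c.getVert 0, by simp [hlast], by simp⟩
  rw [hc.getVert_edge_mem_iff h₀ (by omega)] at h
  rw [hn, Nat.even_add_one]
  tauto

/-- An alternating cycle starts with an edge of the matching, up to reversal. -/
lemma HasAlternatingCycle.exists_first_edge_mem (h : HasAlternatingCycle G M) :
    ∃ (v : W) (c : G.Walk v v), IsAlternatingCycle G M c ∧ s(c.getVert 0, c.getVert 1) ∈ M := by
  obtain ⟨v, c, hc⟩ := h
  by_cases h₀ : s(c.getVert 0, c.getVert 1) ∈ M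
  · exact ⟨v, c, hc, h₀⟩
  have hlen := hc.1.three_le_length
  refine ⟨v, c.reverse, hc.reverse, ?_⟩
  obtain ⟨n, hn⟩ : ∃ n, c.length = n + 1 := ⟨c.length - 1, by omega⟩
  have hlast : c.getVert (n + 1) = c.getVert 0 := by
    rw [← hn, c.getVert_length, c.getVert_zero]
  have hmem := hc.2 _ (edge_getVert_mem_edges c (i := n) (by omega)) _
    (edge_getVert_mem_edges c (i := 0) (by omega))
    (edge_getVert_ne_edge_getVert hc.1.isTrail (by omega) (by omega) (by omega))
    ⟨c.getVert 0, by simp [hlast], by simp⟩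
  have hmem' := hmem.2 h₀
  rw [Sym2.eq_swap] at hmem'
  simpa [SimpleGraph.Walk.getVert_reverse, hn, hlast] using hmem'

/-- Matching edges that can be traversed cyclically, under the closure property `hadj` of Favaron,
yield two matching edges joined in both directions. -/
lemma HasAlternatingCycle.exists_adj_partner (h : HasAlternatingCycle G M) {m : W → W}
    (hm : ∀ u v, s(u, v) ∈ M ↔ v = m u)
    (hadj : ∀ x u v, G.Adj u x → G.Adj v (m x) → G.Adj u v) :
    ∃ x y, x ≠ y ∧ G.Adj (m x) y ∧ G.Adj (m y) x := by
  obtain ⟨v, c, hc, h₀⟩ := h.exists_first_edge_mem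
  have hlen := hc.1.three_le_length
  have heven := hc.even_length h₀
  obtain ⟨n, hn⟩ : ∃ n, c.length = 2 * n + 4 := by
    obtain ⟨k, hk⟩ := heven
    exact ⟨k - 2, by omega⟩
  have hstep : ∀ k, 2 * k < c.length → G.Adj (m (c.getVert (2 * k))) (c.getVert (2 * k + 2)) := by
    intro k hk
    have h₁ := (hc.getVert_edge_mem_iff h₀ hk).2 (even_two_mul k)
    rw [hm] at h₁
    rw [← h₁]
    exact c.adj_getVert_succ (by omega)
  have hchain : ∀ k ≤ n, G.Adj (m (c.getVert 2)) (c.getVert (2 * k + 4)) := by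
    intro k
    induction k with
    | zero => exact fun _ => hstep 1 (by omega)
    | succ k ih =>
      intro hk
      exact hadj _ _ _ (ih (by omega)) (hstep (k + 2) (by omega)).symm
  refine ⟨c.getVert 0, c.getVert 2, fun h => ?_, hstep 0 (by omega), ?_⟩
  · have := hc.1.getVert_injOn' (by simp) (by simp only [Set.mem_ofPred_eq]; omega) h
    omega
  · have := hchain n le_rfl
    rw [← hn, c.getVert_length] at this
    rwa [c.getVert_zero]

lemma exists_alternating_chordless_four_cycle {m : W → W} (hM : IsGMatching G M)
    (hm : ∀ u v, s(u, v) ∈ M ↔ v = m u)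
    (hadj : ∀ x u v, G.Adj u x → G.Adj v (m x) → G.Adj u v)
    {x y : W} (hne : x ≠ y) (hxy : G.Adj (m x) y) (hyx : G.Adj (m y) x) :
    ∃ (v : W) (c : G.Walk v v), IsAlternatingCycle G M c ∧ ChordlessCycle G c ∧ c.length = 4 := by
  have hadjm : ∀ v, G.Adj v (m v) := fun v => hM.1 _ ((hm _ _).2 rfl)
  have hinv : ∀ v, m (m v) = v := fun v => by
    rw [eq_comm, ← hm, Sym2.eq_swap, hm]
  have hx := hadjm x
  have hy := hadjm y
  have hmne : m x ≠ m y := fun h => hne (by rw [← hinv x, h, hinv])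
  have hnxy : ¬ G.Adj x y := fun h => G.irrefl (hadj x y y h.symm hxy.symm)
  have hnmxy : ¬ G.Adj (m x) (m y) := fun h => G.irrefl (hadj x (m y) (m y) hyx h.symm)
  have h₁ := hx.ne
  have h₂ := hy.ne
  have h₃ := hxy.ne
  have h₄ := hyx.ne
  refine ⟨x, .cons hx (.cons hxy (.cons hy (.cons hyx .nil))), ⟨?_, ?_⟩, ?_, rfl⟩
  · simp [SimpleGraph.Walk.isCycle_def, SimpleGraph.Walk.isTrail_def]
    grind
  · intro e he f hf hef
    simp only [SimpleGraph.Walk.edges_cons, SimpleGraph.Walk.edges_nil, List.mem_cons,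
      List.not_mem_nil, or_false] at he hf
    rcases he with rfl | rfl | rfl | rfl <;> rcases hf with rfl | rfl | rfl | rfl <;>
      simp only [hm, hinv, Sym2.mem_iff] <;> grind
  · intro a ha b hb hab
    simp only [SimpleGraph.Walk.support_cons, SimpleGraph.Walk.support_nil, List.mem_cons,
      List.not_mem_nil, or_false] at ha hb
    simp only [SimpleGraph.Walk.edges_cons, SimpleGraph.Walk.edges_nil, List.mem_cons]
    have := hab.symm
    have := hab.ne
    grind

end AlternatingCycle

section VeryWellCovered

variable {W : Type*} {G : SimpleGraph W} {M : Finset (Sym2 W)} {S T : Finset W}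

lemma IsStable.subset (hT : IsStable G T) (h : S ⊆ T) : IsStable G S :=
  fun _ hx _ hy => hT (h hx) (h hy)

variable [Fintype W]

lemma IsStable.card_le_alpha (hS : IsStable G S) : S.card ≤ alpha G := by
  refine le_csSup ⟨Fintype.card W, ?_⟩ ⟨S, S.subset_univ, hS, rfl⟩
  rintro n ⟨T, -, -, rfl⟩
  exact T.card_le_univ

lemma exists_isStable_card_eq_alpha (G : SimpleGraph W) :
    ∃ S, IsStable G S ∧ S.card = alpha G := by
  have hmem := Nat.sSup_mem (s := {n | ∃ S ⊆ Finset.univ, IsStable G S ∧ S.card = n})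
    ⟨0, ∅, by simp, by simp [IsStable], rfl⟩ ⟨Fintype.card W, by
      rintro n ⟨T, -, -, rfl⟩
      exact T.card_le_univ⟩
  obtain ⟨S, -, hS, hcard⟩ := hmem
  exact ⟨S, hS, hcard⟩

lemma IsGMatching.card_le_mu (hM : IsGMatching G M) : M.card ≤ mu G := by
  refine le_csSup ⟨Fintype.card (Sym2 W), ?_⟩ ⟨M, ⟨hM, by simp⟩, rfl⟩
  rintro n ⟨N, -, rfl⟩
  exact N.card_le_univ

lemma IsStable.exists_isMaximalStable (hS : IsStable G S) :
    ∃ T, S ⊆ T ∧ IsMaximalStable G T := by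
  obtain ⟨T, hST, hT⟩ := (Set.toFinite {T | IsStable G T}).exists_le_maximal hS
  exact ⟨T, hST, hT.1, fun U hU h => Finset.Subset.antisymm h (hT.2 hU h)⟩

lemma WellCovered.card_eq_alpha (hG : WellCovered G) (hT : IsMaximalStable G T) :
    T.card = alpha G := by
  obtain ⟨S, hS, hcard⟩ := exists_isStable_card_eq_alpha G
  rw [← hcard]
  refine hG T S hT ⟨hS, fun U hU h => Finset.eq_of_subset_of_card_le h ?_⟩
  exact hcard ▸ hU.card_le_alpha

/-- Stable sets in a well-covered graph without isolated vertices satisfy Hall's condition. -/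
lemma WellCovered.card_le_card_biUnion_neighbors (hG : WellCovered G)
    (hiso : ∀ v : W, ∃ u, G.Adj v u) (A : Finset W) (hA : IsStable G A) :
    A.card ≤ (A.biUnion fun a => Finset.univ.filter (G.Adj a)).card := by
  induction A using Finset.strongInduction with
  | H A ih =>
  obtain rfl | ⟨a, ha⟩ := A.eq_empty_or_nonempty
  · simp
  obtain ⟨v, hv⟩ := hiso a
  obtain ⟨T, hvT, hT⟩ := IsStable.exists_isMaximalStable (G := G) (S := {v}) (by simp [IsStable])
  rw [Finset.singleton_subset_iff] at hvT
  set N := A.biUnion fun a => Finset.univ.filter (G.Adj a) with hN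
  have memN : ∀ u, u ∈ N ↔ ∃ a ∈ A, G.Adj a u := by simp [hN]
  set B := T ∩ N
  set A₀ := A.filter fun a => ∀ b ∈ B, ¬ G.Adj a b with hA₀
  have hA₀A : A₀ ⊆ A := Finset.filter_subset _ _
  have hvB : v ∈ B := Finset.mem_inter.2 ⟨hvT, (memN v).2 ⟨a, ha, hv⟩⟩
  have hlt : A₀ ⊂ A := by
    refine (Finset.ssubset_iff_of_subset hA₀A).2 ⟨a, ha, fun h => ?_⟩
    exact (Finset.mem_filter.1 h).2 v hvB hv
  have hrec := ih A₀ hlt (hA.subset hA₀A)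
  have hsub : (A₀.biUnion fun a => Finset.univ.filter (G.Adj a)) ⊆ N \ B := by
    intro u hu
    simp only [Finset.mem_biUnion, Finset.mem_filter, Finset.mem_univ, true_and] at hu
    obtain ⟨b, hb, hbu⟩ := hu
    exact Finset.mem_sdiff.2 ⟨(memN u).2 ⟨b, hA₀A hb, hbu⟩,
      fun h => (Finset.mem_filter.1 hb).2 u h hbu⟩
  have hA₀T : A₀ ⊆ T := by
    intro b hb
    have hst : IsStable G (insert b T) := by
      have key : ∀ t ∈ T, ¬ G.Adj b t := fun t ht h =>
        (Finset.mem_filter.1 hb).2 t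
          (Finset.mem_inter.2 ⟨ht, (memN t).2 ⟨b, hA₀A hb, h⟩⟩) h
      intro x hx y hy hxy
      rw [Finset.mem_insert] at hx hy
      rcases hx with rfl | hx <;> rcases hy with rfl | hy
      · exact hxy.ne rfl
      · exact key y hy hxy
      · exact key x hx hxy.symm
      · exact hT.1 hx hy hxy
    rw [hT.2 _ hst (Finset.subset_insert _ _)]
    exact Finset.mem_insert_self _ _
  have hswap : IsStable G ((T \ B) ∪ (A \ A₀)) := by
    have key : ∀ t ∈ T \ B, ∀ b ∈ A, ¬ G.Adj b t := fun t ht b hb h => by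
      rw [Finset.mem_sdiff] at ht
      exact ht.2 (Finset.mem_inter.2 ⟨ht.1, (memN t).2 ⟨b, hb, h⟩⟩)
    intro x hx y hy hxy
    rw [Finset.mem_union] at hx hy
    rcases hx with hx | hx <;> rcases hy with hy | hy
    · exact hT.1 (Finset.mem_sdiff.1 hx).1 (Finset.mem_sdiff.1 hy).1 hxy
    · exact key x hx y (Finset.mem_sdiff.1 hy).1 hxy.symm
    · exact key y hy x (Finset.mem_sdiff.1 hx).1 hxy
    · exact hA (Finset.mem_sdiff.1 hx).1 (Finset.mem_sdiff.1 hy).1 hxy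
  have hdisj : Disjoint (T \ B) (A \ A₀) := by
    rw [Finset.disjoint_left]
    intro x hx hx'
    rw [Finset.mem_sdiff] at hx hx'
    refine hx'.2 (Finset.mem_filter.2 ⟨hx'.1, fun b hb => ?_⟩)
    exact hT.1 hx.1 (Finset.mem_inter.1 hb).1
  have hle := hswap.card_le_alpha
  rw [← hG.card_eq_alpha hT, Finset.card_union_of_disjoint hdisj] at hle
  have h₁ := Finset.card_sdiff_add_card_eq_card (show B ⊆ T from Finset.inter_subset_left)
  have h₂ := Finset.card_sdiff_add_card_eq_card (show B ⊆ N from Finset.inter_subset_right)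
  have h₃ := Finset.card_sdiff_add_card_eq_card hA₀A
  have h₄ := Finset.card_le_card hsub
  omega

lemma WellCovered.alpha_le_mu (hG : WellCovered G) (hiso : ∀ v : W, ∃ u, G.Adj v u) :
    alpha G ≤ mu G := by
  obtain ⟨S, hS, hcard⟩ := exists_isStable_card_eq_alpha G
  obtain ⟨f, hf, hadj⟩ := (Finset.all_card_le_biUnion_card_iff_exists_injective
    fun a : S => Finset.univ.filter (G.Adj a)).1 fun A => by
      have h := hG.card_le_card_biUnion_neighbors hiso (A.map (Function.Embedding.subtype _))
        (hS.subset fun x hx => by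
          obtain ⟨y, -, rfl⟩ := Finset.mem_map.1 hx
          exact y.2)
      rw [Finset.card_map] at h
      refine h.trans (Finset.card_le_card fun u hu => ?_)
      simp only [Finset.mem_biUnion, Finset.mem_map] at hu ⊢
      obtain ⟨_, ⟨b, hb, rfl⟩, hu⟩ := hu
      exact ⟨b, hb, hu⟩
  replace hadj : ∀ x : S, G.Adj x (f x) := fun x => (Finset.mem_filter.1 (hadj x)).2
  have hfS : ∀ x y : S, f x ≠ y := fun x y h => hS x.2 y.2 (h ▸ hadj x)
  have hmatch : IsGMatching G (Finset.univ.image fun x : S => s((x : W), f x)) := by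
    refine ⟨fun e he => ?_, fun e he e' he' hne v hv hv' => hne ?_⟩
    · obtain ⟨x, -, rfl⟩ := Finset.mem_image.1 he
      exact hadj x
    · obtain ⟨x, -, rfl⟩ := Finset.mem_image.1 he
      obtain ⟨y, -, rfl⟩ := Finset.mem_image.1 he'
      rw [Sym2.mem_iff] at hv hv'
      have : x = y := by
        rcases hv with rfl | rfl <;> rcases hv' with h | h
        · exact Subtype.ext h
        · exact absurd h.symm (hfS y x)
        · exact absurd h (hfS x y)
        · exact hf h
      rw [this]
  have hle := hmatch.card_le_mu
  rwa [Finset.card_image_of_injective, Finset.card_univ, Fintype.card_coe, hcard] at hle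
  intro x y hxy
  rcases Sym2.eq_iff.1 hxy with h | h
  · exact Subtype.ext h.1
  · exact absurd h.1.symm (hfS y x)

lemma card_msupp (hM : IsGMatching G M) : (msupp M).card = 2 * M.card := by
  have h : msupp M = M.biUnion fun e => e.toFinset := by
    ext v
    simp [msupp]
  rw [h, Finset.card_biUnion, Finset.sum_const_nat (m := 2), mul_comm]
  · exact fun e he => Sym2.card_toFinset_of_not_isDiag e (G.not_isDiag_of_mem_edgeSet (hM.1 e he))
  · intro e he f hf hne
    rw [Function.onFun, Finset.disjoint_left]
    intro v hv hv'
    exact hM.2 e he f hf hne v (Sym2.mem_toFinset.1 hv) (Sym2.mem_toFinset.1 hv')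

lemma VeryWellCovered.card_eq_alpha (hG : VeryWellCovered G) (hM : IsMaximumGMatching G M) :
    M.card = alpha G := by
  have h₁ := hG.1.alpha_le_mu hG.2.1
  have h₂ := (msupp M).card_le_univ
  rw [card_msupp hM.1, hG.2.2] at h₂
  have h₃ := hM.2
  omega

lemma VeryWellCovered.isPerfectGMatching (hG : VeryWellCovered G) (hM : IsMaximumGMatching G M) :
    IsPerfectGMatching G M := by
  refine ⟨hM.1, fun v => ?_⟩
  have h : msupp M = Finset.univ := by
    rw [← Finset.card_eq_iff_eq_univ, card_msupp hM.1, hG.card_eq_alpha hM, hG.2.2]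
  have hv : v ∈ msupp M := h ▸ Finset.mem_univ v
  exact (Finset.mem_filter.1 hv).2

/-- Favaron's property of perfect matchings in very well-covered graphs. -/
lemma VeryWellCovered.adj_of_adj_of_adj (hG : VeryWellCovered G) (hM : IsMaximumGMatching G M)
    {x y u v : W} (hxy : s(x, y) ∈ M) (hu : G.Adj u x) (hv : G.Adj v y) : G.Adj u v := by
  by_contra huv
  have hst : IsStable G {u, v} := by
    intro a ha b hb
    simp only [Finset.mem_insert, Finset.mem_singleton] at ha hb
    rcases ha with rfl | rfl <;> rcases hb with rfl | rfl
    · exact G.irrefl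
    · exact huv
    · exact fun h => huv h.symm
    · exact G.irrefl
  obtain ⟨T, hsub, hT⟩ := hst.exists_isMaximalStable
  obtain ⟨m, hm⟩ := (hG.isPerfectGMatching hM).exists_partner
  have himg : T.image (fun t => s(t, m t)) = M := by
    apply Finset.eq_of_subset_of_card_le
    · intro e he
      obtain ⟨t, -, rfl⟩ := Finset.mem_image.1 he
      exact (hm _ _).2 rfl
    · rw [Finset.card_image_of_injOn, hG.card_eq_alpha hM, hG.1.card_eq_alpha hT]
      intro a ha b hb hab
      rcases Sym2.eq_iff.1 hab with h | h
      · exact h.1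
      · have hmem : s(b, a) ∈ M := (hm _ _).2 h.1
        exact absurd (hM.1.1 _ hmem) (hT.1 hb ha)
  rw [← himg] at hxy
  obtain ⟨t, ht, hteq⟩ := Finset.mem_image.1 hxy
  rcases Sym2.eq_iff.1 hteq with h | h
  · exact hT.1 (hsub (by simp)) ht (h.1 ▸ hu)
  · exact hT.1 (hsub (by simp)) ht (h.1 ▸ hv)

end VeryWellCovered

/-- For a maximum matching `M` of a very well-covered graph `G`,
`G` contains an `M`-alternating cycle iff it contains an `M`-alternating
chordless cycle of length four. -/
theorem alternating_cycle_iff_alternating_chordless_c4 (G : SimpleGraph V)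
    (hG : VeryWellCovered G) (M : Finset (Sym2 V))
    (hM : IsMaximumGMatching G M) :
    HasAlternatingCycle G M ↔
      ∃ (v : V) (c : G.Walk v v),
        IsAlternatingCycle G M c ∧ ChordlessCycle G c ∧ c.length = 4 := by
  refine ⟨fun h => ?_, fun ⟨v, c, hc, _⟩ => ⟨v, c, hc⟩⟩
  obtain ⟨m, hm⟩ := (hG.isPerfectGMatching hM).exists_partner
  have hadj : ∀ x u v, G.Adj u x → G.Adj v (m x) → G.Adj u v :=
    fun x _ _ => hG.adj_of_adj_of_adj hM ((hm x _).2 rfl)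
  obtain ⟨x, y, hne, hxy, hyx⟩ := h.exists_adj_partner hm hadj
  exact exists_alternating_chordless_four_cycle hM.1 hm hadj hne hxy hyx
end
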